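/- arXiv:2404.01759 — 5 statements merged into one kernel-verified Lean document; each statement's English description precedes it below -/
import Mathlib

section
/- Under assumption (P1), for every x ∈ ℝ^N \ {0} one has inf { |x−y|^{N+s·p(x,y)} / (1 + |y|^{N+s·p(x,y)}) : y ∈ ℝ^N, |x−y| > 1 } > 0. -/
open MeasureTheory Filter Set

/-- Bound for the ratio of powers of the distances from `y` to `x` and to the origin, away from
`x`, uniform over exponents in `[0, b]`. -/
theorem inv_le_norm_sub_rpow_div {E : Type*} [SeminormedAddCommGroup E] {x y : E} {a b : ℝ}
    (ha : 0 ≤ a) (hab : a ≤ b) (hxy : 1 ≤ ‖x - y‖) :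
    (2 * (1 + ‖x‖) ^ b)⁻¹ ≤ ‖x - y‖ ^ a / (1 + ‖y‖ ^ a) := by
  have hx : 1 ≤ 1 + ‖x‖ := by linarith [norm_nonneg x]
  have hC : 1 ≤ (1 + ‖x‖) ^ b := Real.one_le_rpow hx (ha.trans hab)
  have ht : 1 ≤ ‖x - y‖ ^ a := Real.one_le_rpow hxy ha
  have hy : ‖y‖ ≤ (1 + ‖x‖) * ‖x - y‖ := by
    have h : ‖y‖ ≤ ‖x‖ + ‖x - y‖ := by simpa using norm_sub_le x (x - y)
    nlinarith [norm_nonneg x]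
  have hya : ‖y‖ ^ a ≤ (1 + ‖x‖) ^ b * ‖x - y‖ ^ a :=
    calc ‖y‖ ^ a ≤ ((1 + ‖x‖) * ‖x - y‖) ^ a := Real.rpow_le_rpow (norm_nonneg y) hy ha
      _ = (1 + ‖x‖) ^ a * ‖x - y‖ ^ a := Real.mul_rpow (by positivity) (norm_nonneg _)
      _ ≤ (1 + ‖x‖) ^ b * ‖x - y‖ ^ a := by gcongr
  have hpos : 0 < 1 + ‖y‖ ^ a := by positivity
  rw [le_div_iff₀ hpos, inv_mul_le_iff₀ (by positivity)]
  nlinarith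

theorem stmt0 (N : ℕ) [NeZero N] (s : ℝ) (hs0 : 0 < s) (hs1 : s < 1)
    (p : EuclideanSpace ℝ (Fin N) → EuclideanSpace ℝ (Fin N) → ℝ)
    (pminus pplus m : ℝ)
    -- (P1)
    (hp_cont : Continuous (fun z : EuclideanSpace ℝ (Fin N) × EuclideanSpace ℝ (Fin N) => p z.1 z.2))
    (hp2 : ∀ x y, 2 < p x y)
    (hpmin : ∀ x y, pminus ≤ p x y) (hpmin_att : ∃ x y, p x y = pminus)
    (hpmax : ∀ x y, p x y ≤ pplus) (hpmax_att : ∃ x y, p x y = pplus)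
    (hm0 : 0 < m) (hm1 : m < 1) (hmlog : 1 - 1 / Real.log m < pminus)
    (hspN : s * pplus < N)
    (x : EuclideanSpace ℝ (Fin N)) (hx : x ≠ 0) :
    0 < sInf {r : ℝ | ∃ y : EuclideanSpace ℝ (Fin N), 1 < ‖x - y‖ ∧
        r = ‖x - y‖ ^ ((N : ℝ) + s * p x y) / (1 + ‖y‖ ^ ((N : ℝ) + s * p x y))} := by
  refine lt_of_lt_of_le (b := (2 * (1 + ‖x‖) ^ ((N : ℝ) + s * pplus))⁻¹) (by positivity)
    (le_csInf ?_ ?_)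
  · refine ⟨_, x - (2 * ‖x‖⁻¹) • x, ?_, rfl⟩
    rw [sub_sub_cancel, norm_smul, norm_mul, norm_inv, norm_norm, mul_assoc,
      inv_mul_cancel₀ (norm_ne_zero_iff.mpr hx)]
    norm_num
  · rintro r ⟨y, hy, rfl⟩
    have hp : 0 < p x y := two_pos.trans (hp2 x y)
    exact inv_le_norm_sub_rpow_div (by positivity) (by gcongr; exact hpmax x y) hy.le
end

section
/- Under assumptions (P1)–(P2), if u ∈ C^{1,1}_loc(ℝ^N) ∩ L_{sp(x,·)}, then the fractional p(x,·)-Laplacian (-Δ)^s_{p(x,·)}u(x) is pointwise well defined for every x ∈ ℝ^N: the principal value limit lim_{ε→0⁺} ∫_{{y ∈ ℝ^N : |y−x| > ε}} |u(x)−u(y)|^{p(x,y)−2}(u(x)−u(y)) / |x−y|^{N+s·p(x,y)} dy exists and is finite. -/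
open MeasureTheory Filter Set

/-- Lipschitz bound for `t ↦ t ^ (r + 1)` on `[0, M]`. -/
lemma abs_rpow_add_one_sub_le {r M a c : ℝ} (hr : 0 ≤ r) (ha0 : 0 ≤ a) (ha : a ≤ M) (hc0 : 0 ≤ c)
    (hc : c ≤ M) : |a ^ (r + 1) - c ^ (r + 1)| ≤ (r + 1) * M ^ r * |a - c| := by
  refine Convex.norm_image_sub_le_of_norm_hasDerivWithin_le (s := Icc 0 M)
    (f := fun t : ℝ => t ^ (r + 1)) (f' := fun t => (r + 1) * t ^ r) (fun t _ => ?_)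
    (fun t ht => ?_) (convex_Icc 0 M) ⟨hc0, hc⟩ ⟨ha0, ha⟩
  · have h := Real.hasDerivAt_rpow_const (x := t) (p := r + 1) (Or.inr (by linarith))
    rw [add_sub_cancel_right] at h
    exact h.hasDerivWithinAt
  · have h0 : 0 ≤ t ^ r := Real.rpow_nonneg ht.1 r
    rw [Real.norm_of_nonneg (by positivity)]
    gcongr
    exacts [ht.1, ht.2]

/-- Lipschitz bound for the odd power `t ↦ |t| ^ r * t` on `[-M, M]`. -/
lemma abs_abs_rpow_mul_sub_le {r M a c : ℝ} (hr : 0 ≤ r) (ha : |a| ≤ M) (hc : |c| ≤ M) :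
    |(|a| ^ r * a - |c| ^ r * c)| ≤ (r + 1) * M ^ r * |a - c| := by
  have hpow : ∀ t : ℝ, |t| ^ r * |t| = |t| ^ (r + 1) := fun t =>
    (Real.rpow_add_one' (abs_nonneg t) (by linarith)).symm
  have same := abs_rpow_add_one_sub_le hr (abs_nonneg a) ha (abs_nonneg c) hc
  rw [← hpow a, ← hpow c] at same
  have opp : |a| ^ r * |a| + |c| ^ r * |c| ≤ (r + 1) * M ^ r * (|a| + |c|) := by
    have h1 : |a| ^ r ≤ M ^ r := by gcongr
    have h2 : |c| ^ r ≤ M ^ r := by gcongr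
    have hM : 0 ≤ M ^ r := (Real.rpow_nonneg (abs_nonneg a) r).trans h1
    calc |a| ^ r * |a| + |c| ^ r * |c| ≤ M ^ r * |a| + M ^ r * |c| := by gcongr
      _ = 1 * M ^ r * (|a| + |c|) := by ring
      _ ≤ (r + 1) * M ^ r * (|a| + |c|) := by gcongr; linarith
  rcases le_total 0 a with h0a | h0a <;> rcases le_total 0 c with h0c | h0c
  · simpa only [abs_of_nonneg h0a, abs_of_nonneg h0c] using same
  · have e : |a - c| = |a| + |c| := by
      rw [abs_of_nonneg h0a, abs_of_nonpos h0c, abs_of_nonneg (by linarith)]; ring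
    rw [e]
    refine le_trans (le_of_eq ?_) opp
    have h1 : 0 ≤ |a| ^ r * |a| := by positivity
    have h2 : 0 ≤ |c| ^ r * |c| := by positivity
    rw [← abs_of_nonneg (add_nonneg h1 h2)]
    congr 1
    rw [abs_of_nonneg h0a, abs_of_nonpos h0c]; ring
  · have e : |a - c| = |a| + |c| := by
      rw [abs_of_nonpos h0a, abs_of_nonneg h0c, abs_of_nonpos (by linarith)]; ring
    rw [e]
    refine le_trans (le_of_eq ?_) opp
    have h1 : 0 ≤ |a| ^ r * |a| := by positivity
    have h2 : 0 ≤ |c| ^ r * |c| := by positivity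
    rw [← abs_of_nonneg (add_nonneg h1 h2), ← abs_neg]
    congr 1
    rw [abs_of_nonpos h0a, abs_of_nonneg h0c]; ring
  · rw [abs_sub_comm] at same ⊢
    rw [abs_sub_comm a c]
    rw [abs_sub_comm |a| |c|] at same
    simp only [abs_of_nonpos h0a, abs_of_nonpos h0c] at same ⊢
    convert same using 1
    · rw [← abs_neg]; congr 1; ring
    · rw [← abs_neg (c - a)]; congr 2; ring

lemma abs_sub_rpow_le {t a b : ℝ} (ht : 0 ≤ t) :
    |a - b| ^ t ≤ 2 ^ t * (|a| ^ t + |b| ^ t) := by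
  have h1 : |a - b| ≤ 2 * max |a| |b| := by
    have := abs_sub a b
    linarith [le_max_left |a| |b|, le_max_right |a| |b|]
  have ha : 0 ≤ |a| ^ t := by positivity
  have hb : 0 ≤ |b| ^ t := by positivity
  calc |a - b| ^ t ≤ (2 * max |a| |b|) ^ t := by gcongr
    _ = 2 ^ t * (max |a| |b|) ^ t := Real.mul_rpow (by norm_num) (by positivity)
    _ ≤ 2 ^ t * (|a| ^ t + |b| ^ t) := by
      gcongr
      rcases max_cases |a| |b| with ⟨h, _⟩ | ⟨h, _⟩ <;> rw [h] <;> linarith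

section

variable {E : Type*} [NormedAddCommGroup E]

/-- A function integrable away from `x` whose symmetrisation about `x` is integrable near `x`
has a principal value at `x`. -/
lemma tendsto_setIntegral_of_integrableOn_symm [MeasurableSpace E] [BorelSpace E]
    [SecondCountableTopology E] {μ : Measure E} [μ.IsAddLeftInvariant]
    [μ.IsNegInvariant] [NullSingletonClass μ] {F : E → ℝ}
    {x : E} {δ : ℝ} (hδ : 0 < δ) (hF : ∀ ε > 0, IntegrableOn F {y | ε < ‖y - x‖} μ)
    (hsymm : IntegrableOn (fun z => F (x + z) + F (x - z)) (Metric.ball 0 δ) μ) :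
    Tendsto (fun ε : ℝ => ∫ y in {y | ε < ‖y - x‖}, F y ∂μ) (nhdsWithin 0 (Ioi 0))
      (nhds (2⁻¹ * ∫ z, (F (x + z) + F (x - z)) ∂μ)) := by
  set H : E → ℝ := fun z => F (x + z) + F (x - z) with hH
  have hmS : ∀ ε : ℝ, MeasurableSet {y | ε < ‖y - x‖} := fun ε =>
    measurableSet_lt measurable_const (by fun_prop)
  have hmT : ∀ ε : ℝ, MeasurableSet {z : E | ε < ‖z‖} := fun ε =>
    measurableSet_lt measurable_const (by fun_prop)
  have e1 : ∀ ε z, indicator {y | ε < ‖y - x‖} F (x + z)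
      = indicator {z : E | ε < ‖z‖} (fun z => F (x + z)) z := fun ε z => by
    simp [indicator]
  have e2 : ∀ ε z, indicator {y | ε < ‖y - x‖} F (x - z)
      = indicator {z : E | ε < ‖z‖} (fun z => F (x - z)) z := fun ε z => by
    simp [indicator]
  have i1 : ∀ ε > 0, Integrable (indicator {z : E | ε < ‖z‖} (fun z => F (x + z))) μ :=
    fun ε hε => by
      have h := ((integrable_indicator_iff (hmS ε)).2 (hF ε hε)).comp_add_left x
      simpa only [e1] using h
  have i2 : ∀ ε > 0, Integrable (indicator {z : E | ε < ‖z‖} (fun z => F (x - z))) μ :=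
    fun ε hε => by
      have h := ((integrable_indicator_iff (hmS ε)).2 (hF ε hε)).comp_sub_left x
      simpa only [e2] using h
  have eH : ∀ ε, indicator {z : E | ε < ‖z‖} H =
      fun z => indicator {z : E | ε < ‖z‖} (fun z => F (x + z)) z
        + indicator {z : E | ε < ‖z‖} (fun z => F (x - z)) z := fun ε => by
    ext z
    by_cases h : ε < ‖z‖ <;> simp [indicator, h, hH]
  have key : ∀ ε > 0, ∫ y in {y | ε < ‖y - x‖}, F y ∂μ
      = 2⁻¹ * ∫ z, indicator {z : E | ε < ‖z‖} H z ∂μ := fun ε hε => by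
    rw [eH, integral_add (i1 ε hε) (i2 ε hε), ← integral_indicator (hmS ε)]
    simp only [← e1, ← e2]
    rw [integral_add_left_eq_self (μ := μ) (indicator {y | ε < ‖y - x‖} F) x,
      integral_sub_left_eq_self (indicator {y | ε < ‖y - x‖} F) μ x]
    ring
  have hHint : Integrable H μ := by
    have hfar : IntegrableOn H {z : E | δ / 2 < ‖z‖} μ := by
      rw [← integrable_indicator_iff (hmT _), eH]
      exact (i1 _ (half_pos hδ)).add (i2 _ (half_pos hδ))
    have := hfar.union hsymm
    rwa [show {z : E | δ / 2 < ‖z‖} ∪ Metric.ball 0 δ = univ from ?_, integrableOn_univ] at this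
    ext z
    simp only [mem_union, mem_ofPred_eq, mem_ball_zero_iff, mem_univ, iff_true]
    by_contra! h
    linarith
  have hlim : Tendsto (fun ε : ℝ => ∫ z, indicator {z : E | ε < ‖z‖} H z ∂μ)
      (nhdsWithin 0 (Ioi 0)) (nhds (∫ z, H z ∂μ)) := by
    refine tendsto_integral_filter_of_dominated_convergence (fun z => ‖H z‖)
      (Eventually.of_forall fun ε => hHint.1.indicator (hmT ε))
      (Eventually.of_forall fun ε => Eventually.of_forall fun z => norm_indicator_le_norm_self _ _)
      hHint.norm ?_
    have hz : ∀ᵐ z ∂μ, z ≠ 0 := by simp [ae_iff]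
    filter_upwards [hz] with z hz
    refine tendsto_const_nhds.congr' ?_
    filter_upwards [nhdsWithin_le_nhds (Iio_mem_nhds (norm_pos_iff.2 hz))] with ε hε
    exact (indicator_of_mem (show z ∈ {z : E | ε < ‖z‖} from hε) H).symm
  refine (hlim.const_mul 2⁻¹).congr' ?_
  filter_upwards [self_mem_nhdsWithin] with ε hε
  exact (key ε hε).symm

/-- First-order Taylor bound for a function with locally Lipschitz derivative. -/
lemma exists_taylor_bound [NormedSpace ℝ E] {u : E → ℝ} (hu : ContDiff ℝ 1 u)
    (hlip : LocallyLipschitz (fderiv ℝ u)) (x : E) :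
    ∃ K > 0, ∃ δ > 0, ∀ z : E, ‖z‖ < δ → |u (x + z) - u x - fderiv ℝ u x z| ≤ K * ‖z‖ ^ 2 := by
  obtain ⟨K, t, ht, hK⟩ := hlip x
  obtain ⟨δ, hδ, hball⟩ := Metric.mem_nhds_iff.1 ht
  refine ⟨K + 1, by positivity, δ, hδ, fun z hz => ?_⟩
  have h := Convex.norm_image_sub_le_of_norm_hasFDerivWithin_le' (𝕜 := ℝ) (f := u)
    (f' := fderiv ℝ u) (φ := fderiv ℝ u x) (C := K * ‖z‖) (s := Metric.closedBall x ‖z‖)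
    (x := x) (y := x + z)
    (fun y _ => (hu.differentiable one_ne_zero y).hasFDerivAt.hasFDerivWithinAt)
    (fun y hy => ?_) (convex_closedBall _ _) (Metric.mem_closedBall_self (norm_nonneg _)) (by simp)
  · rw [add_sub_cancel_left, Real.norm_eq_abs] at h
    nlinarith [sq_nonneg ‖z‖]
  · rw [Metric.mem_closedBall] at hy
    have hyt : y ∈ t := hball (Metric.mem_ball.2 (hy.trans_lt hz))
    have h2 := hK.dist_le_mul y hyt x (mem_of_mem_nhds ht)
    rw [dist_eq_norm] at h2
    exact h2.trans (by gcongr)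

/-- Away from `x`, weights centred at `x` and at the origin are comparable. -/
lemma one_add_norm_rpow_le {x y : E} {ε r R : ℝ} (hε : 0 < ε) (hy : ε < ‖y - x‖) (hr : 0 ≤ r)
    (hrR : r ≤ R) :
    1 + ‖y‖ ^ r ≤ 2 * (1 + 1 / ε + ‖x‖ / ε) ^ R * ‖y - x‖ ^ r := by
  set K := 1 + 1 / ε + ‖x‖ / ε with hK
  have hK1 : 1 ≤ K := by
    have : 0 ≤ 1 / ε + ‖x‖ / ε := by positivity
    linarith
  have hy0 : 0 < ‖y - x‖ := hε.trans hy
  have hq : 1 ≤ ‖y - x‖ / ε := (one_le_div hε).2 hy.le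
  have a1 : 1 ≤ K * ‖y - x‖ := by
    have : K * ‖y - x‖ = ‖y - x‖ + ‖y - x‖ / ε + ‖x‖ * (‖y - x‖ / ε) := by rw [hK]; ring
    nlinarith [norm_nonneg x]
  have a2 : ‖y‖ ≤ K * ‖y - x‖ := by
    have : K * ‖y - x‖ = ‖y - x‖ + ‖y - x‖ / ε + ‖x‖ * (‖y - x‖ / ε) := by rw [hK]; ring
    have h3 : ‖y‖ ≤ ‖y - x‖ + ‖x‖ := by simpa using norm_add_le (y - x) x
    nlinarith [norm_nonneg x]
  have b1 : 1 ≤ (K * ‖y - x‖) ^ r := Real.one_le_rpow a1 hr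
  have b2 : ‖y‖ ^ r ≤ (K * ‖y - x‖) ^ r := by gcongr
  have b3 : (K * ‖y - x‖) ^ r ≤ K ^ R * ‖y - x‖ ^ r := by
    rw [Real.mul_rpow (by positivity) hy0.le]
    gcongr
  linarith

lemma one_add_rpow_le {S ε r₀ r R : ℝ} (hε : 0 < ε) (hS : ε < S) (hr : 0 ≤ r) (hr₀ : r₀ ≤ r)
    (hrR : r ≤ R) : (1 + S) ^ r₀ ≤ (1 + 1 / ε) ^ R * S ^ r := by
  have hS0 : 0 < S := hε.trans hS
  have hK1 : 1 ≤ 1 + 1 / ε := le_add_of_nonneg_right (by positivity)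
  have h1 : 1 + S ≤ (1 + 1 / ε) * S := by
    have : 1 ≤ S / ε := (one_le_div hε).2 hS.le
    have e : (1 + 1 / ε) * S = S + S / ε := by ring
    linarith
  calc (1 + S) ^ r₀ ≤ (1 + S) ^ r := Real.rpow_le_rpow_of_exponent_le (by linarith) hr₀
    _ ≤ ((1 + 1 / ε) * S) ^ r := by gcongr
    _ = (1 + 1 / ε) ^ r * S ^ r := Real.mul_rpow (by positivity) hS0.le
    _ ≤ (1 + 1 / ε) ^ R * S ^ r := by gcongr

/-- Symmetrised bound for the kernel of the fractional Laplacian of exponent `q` at distance `ρ`. -/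
lemma abs_symm_kernel_le {a b C K ρ q P s n : ℝ} (hρ0 : 0 ≤ ρ) (hρ1 : ρ ≤ 1) (hC : 1 ≤ C)
    (hK : 0 ≤ K) (hq2 : 2 < q) (hqP : q ≤ P) (hs1 : s < 1) (ha : |a| ≤ C * ρ) (hb : |b| ≤ C * ρ)
    (hab : |a + b| ≤ K * ρ ^ 2) :
    |(|a| ^ (q - 2) * a / ρ ^ (n + s * q) + |b| ^ (q - 2) * b / ρ ^ (n + s * q))|
      ≤ P * C ^ P * K * ρ ^ (-(n - 2 * (1 - s))) := by
  rcases hρ0.eq_or_lt with rfl | hρ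
  · have ha0 : a = 0 := by simpa using ha
    have hb0 : b = 0 := by simpa using hb
    have : 0 ≤ (0 : ℝ) ^ (-(n - 2 * (1 - s))) := Real.rpow_nonneg le_rfl _
    have hP : 0 ≤ P := by linarith
    rw [ha0, hb0]
    simp only [mul_zero, zero_div, add_zero, abs_zero]
    positivity
  · have h := abs_abs_rpow_mul_sub_le (r := q - 2) (by linarith) ha
      (by rwa [abs_neg] : |(-b)| ≤ C * ρ)
    rw [abs_neg, mul_neg, sub_neg_eq_add, sub_neg_eq_add] at h
    rw [← add_div, abs_div, abs_of_pos (Real.rpow_pos_of_pos hρ _), div_le_iff₀ (by positivity)]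
    have hexp : ρ ^ (q - 2) * ρ ^ 2 ≤ ρ ^ (-(n - 2 * (1 - s))) * ρ ^ (n + s * q) := by
      rw [← Real.rpow_natCast ρ 2, ← Real.rpow_add hρ, ← Real.rpow_add hρ]
      refine Real.rpow_le_rpow_of_exponent_ge hρ hρ1 ?_
      push_cast
      nlinarith
    calc |(|a| ^ (q - 2) * a + |b| ^ (q - 2) * b)|
        ≤ (q - 2 + 1) * (C * ρ) ^ (q - 2) * |a + b| := h
      _ = (q - 1) * C ^ (q - 2) * ρ ^ (q - 2) * |a + b| := by
          rw [Real.mul_rpow (by linarith) hρ0]; ring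
      _ ≤ P * C ^ P * ρ ^ (q - 2) * (K * ρ ^ 2) := by
          have hP : 0 ≤ P := by linarith
          have hCP : 0 ≤ C ^ P := by positivity
          gcongr <;> linarith
      _ = P * C ^ P * K * (ρ ^ (q - 2) * ρ ^ 2) := by ring
      _ ≤ P * C ^ P * K * (ρ ^ (-(n - 2 * (1 - s))) * ρ ^ (n + s * q)) := by
          have hP : 0 ≤ P := by linarith
          gcongr
      _ = _ := by ring

end

theorem stmt1 (N : ℕ) [NeZero N] (s : ℝ) (hs0 : 0 < s) (hs1 : s < 1)
    (p : EuclideanSpace ℝ (Fin N) → EuclideanSpace ℝ (Fin N) → ℝ)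
    (pminus pplus m : ℝ) (Q : ℝ → ℝ)
    -- (P1)
    (hp_cont : Continuous (fun z : EuclideanSpace ℝ (Fin N) × EuclideanSpace ℝ (Fin N) => p z.1 z.2))
    (hp2 : ∀ x y, 2 < p x y)
    (hpmin : ∀ x y, pminus ≤ p x y) (hpmin_att : ∃ x y, p x y = pminus)
    (hpmax : ∀ x y, p x y ≤ pplus) (hpmax_att : ∃ x y, p x y = pplus)
    (hm0 : 0 < m) (hm1 : m < 1) (hmlog : 1 - 1 / Real.log m < pminus)
    (hspN : s * pplus < N)
    -- (P2)
    (hQcont : Continuous Q) (hQmono : MonotoneOn Q (Set.Ici 0))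
    (hpQ : ∀ x y, p x y = Q ‖x - y‖)
    (hQtt : StrictMonoOn (fun t : ℝ => t ^ Q t) (Set.Ioi 0))
    -- u ∈ C^{1,1}_loc ∩ L_{sp(x,·)}
    (u : EuclideanSpace ℝ (Fin N) → ℝ)
    (hu_C1 : ContDiff ℝ 1 u) (hu_lip : LocallyLipschitz (fderiv ℝ u))
    (hu_loc : LocallyIntegrable u)
    (hu_Lsp : ∀ x, Integrable (fun y : EuclideanSpace ℝ (Fin N) =>
        |u y| ^ (p x y - 1) / (1 + ‖y‖ ^ ((N : ℝ) + s * p x y)))) :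
    ∀ x : EuclideanSpace ℝ (Fin N),
      (∀ ε : ℝ, 0 < ε → IntegrableOn
          (fun y => |u x - u y| ^ (p x y - 2) * (u x - u y) / ‖x - y‖ ^ ((N : ℝ) + s * p x y))
          {y | ε < ‖y - x‖}) ∧
      ∃ L : ℝ, Tendsto
          (fun ε : ℝ => ∫ y in {y : EuclideanSpace ℝ (Fin N) | ε < ‖y - x‖},
            |u x - u y| ^ (p x y - 2) * (u x - u y) / ‖x - y‖ ^ ((N : ℝ) + s * p x y))
          (nhdsWithin 0 (Set.Ioi 0)) (nhds L) := by
  intro x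
  set F : EuclideanSpace ℝ (Fin N) → ℝ := fun y =>
    |u x - u y| ^ (p x y - 2) * (u x - u y) / ‖x - y‖ ^ ((N : ℝ) + s * p x y) with hF
  have hu_cont : Continuous u := hu_C1.continuous
  have hpx : Continuous (p x) := hp_cont.comp (by fun_prop : Continuous fun y => (x, y))
  have hFm : Measurable F := by
    have h1 : Measurable u := hu_cont.measurable
    have h2 : Measurable (p x) := hpx.measurable
    fun_prop
  have hsp : ∀ y, s * 2 < s * p x y := fun y => by have := hp2 x y; gcongr
  have hfar : ∀ ε : ℝ, 0 < ε → IntegrableOn F {y | ε < ‖y - x‖} := by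
    intro ε hε
    set R : ℝ := N + s * pplus
    set A : ℝ := (1 + 1 / ε) ^ R
    set B : ℝ := 2 * (1 + 1 / ε + ‖x‖ / ε) ^ R
    have hdecay : Integrable fun y : EuclideanSpace ℝ (Fin N) =>
        (1 + ‖y - x‖) ^ (-((N : ℝ) + s * 2)) :=
      (integrable_one_add_norm (μ := (volume : Measure (EuclideanSpace ℝ (Fin N))))
        (r := (N : ℝ) + s * 2) (by simpa using hs0)).comp_sub_right x
    refine ((((hdecay.const_mul A).const_mul ((1 + |u x|) ^ pplus)).add
      ((hu_Lsp x).const_mul B)).const_mul ((2 : ℝ) ^ pplus)).integrableOn.mono'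
      hFm.aestronglyMeasurable ?_
    refine (ae_restrict_iff' (measurableSet_lt measurable_const (by fun_prop))).2
      (Eventually.of_forall fun y hy => ?_)
    have hy : ε < ‖y - x‖ := hy
    have hq2 := hp2 x y
    have hqP := hpmax x y
    have hspy := hsp y
    have hsP : s * p x y ≤ s * pplus := by gcongr
    have hF' : ‖F y‖ = |u x - u y| ^ (p x y - 1) / ‖y - x‖ ^ ((N : ℝ) + s * p x y) := by
      rw [hF, Real.norm_eq_abs, abs_div, abs_mul, norm_sub_rev x y,
        abs_of_nonneg (Real.rpow_nonneg (abs_nonneg _) _),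
        abs_of_nonneg (Real.rpow_nonneg (norm_nonneg _) _),
        ← Real.rpow_add_one' (abs_nonneg _) (by linarith)]
      congr 2
      ring
    have hN0 : (0 : ℝ) ≤ N := Nat.cast_nonneg N
    have hS : 0 < ‖y - x‖ := hε.trans hy
    have hSr : 0 < ‖y - x‖ ^ ((N : ℝ) + s * p x y) := by positivity
    have hA : 1 / ‖y - x‖ ^ ((N : ℝ) + s * p x y)
        ≤ A * (1 + ‖y - x‖) ^ (-((N : ℝ) + s * 2)) := by
      have := one_add_rpow_le (r₀ := N + s * 2) (r := N + s * p x y) (R := R) hε hy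
        (by linarith) (by linarith) (by linarith)
      rw [Real.rpow_neg (by positivity), ← div_eq_mul_inv, div_le_div_iff₀ hSr (by positivity)]
      linarith
    have hB : 1 / ‖y - x‖ ^ ((N : ℝ) + s * p x y) ≤ B / (1 + ‖y‖ ^ ((N : ℝ) + s * p x y)) := by
      have := one_add_norm_rpow_le (r := N + s * p x y) (R := R) hε hy
        (by linarith) (by linarith)
      rw [div_le_div_iff₀ hSr (by positivity)]
      linarith
    have hux : |u x| ^ (p x y - 1) ≤ (1 + |u x|) ^ pplus := by
      have h0 : 0 ≤ |u x| := abs_nonneg _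
      calc |u x| ^ (p x y - 1) ≤ (1 + |u x|) ^ (p x y - 1) := by gcongr <;> linarith
        _ ≤ (1 + |u x|) ^ pplus :=
          Real.rpow_le_rpow_of_exponent_le (by linarith) (by linarith)
    have h2 : (2 : ℝ) ^ (p x y - 1) ≤ 2 ^ pplus :=
      Real.rpow_le_rpow_of_exponent_le (by norm_num) (by linarith)
    rw [hF']
    calc |u x - u y| ^ (p x y - 1) / ‖y - x‖ ^ ((N : ℝ) + s * p x y)
        ≤ 2 ^ (p x y - 1) * (|u x| ^ (p x y - 1) + |u y| ^ (p x y - 1))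
          / ‖y - x‖ ^ ((N : ℝ) + s * p x y) := by
          gcongr
          exact abs_sub_rpow_le (by linarith)
      _ ≤ 2 ^ pplus * ((1 + |u x|) ^ pplus + |u y| ^ (p x y - 1))
          / ‖y - x‖ ^ ((N : ℝ) + s * p x y) := by gcongr
      _ = 2 ^ pplus * ((1 + |u x|) ^ pplus * (1 / ‖y - x‖ ^ ((N : ℝ) + s * p x y))
          + |u y| ^ (p x y - 1) * (1 / ‖y - x‖ ^ ((N : ℝ) + s * p x y))) := by ring
      _ ≤ 2 ^ pplus * ((1 + |u x|) ^ pplus * (A * (1 + ‖y - x‖) ^ (-((N : ℝ) + s * 2)))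
          + |u y| ^ (p x y - 1) * (B / (1 + ‖y‖ ^ ((N : ℝ) + s * p x y)))) := by gcongr
      _ = _ := by simp only [Pi.add_apply]; ring
  refine ⟨hfar, ?_⟩
  obtain ⟨K, hK, δ, hδ, hT⟩ := exists_taylor_bound hu_C1 hu_lip x
  set D := fderiv ℝ u x
  have hnear : IntegrableOn (fun z => F (x + z) + F (x - z)) (Metric.ball 0 (min δ 1)) := by
    refine integrableOn_ball_of_norm_le_rpow
      (C := pplus * (1 + ‖D‖ + K) ^ pplus * (2 * K)) (α := (N : ℝ) - 2 * (1 - s)) ?_ ?_ ?_ ?_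
    · simpa using NeZero.one_le
    · simpa using hs1
    · refine (ae_restrict_iff' measurableSet_ball).2 (Eventually.of_forall fun z hz => ?_)
      rw [mem_ball_zero_iff, lt_min_iff] at hz
      have t1 := hT z hz.1
      have t2 := hT (-z) ((norm_neg z).trans_lt hz.1)
      rw [map_neg, norm_neg, ← sub_eq_add_neg] at t2
      have hD : |D z| ≤ ‖D‖ * ‖z‖ := D.le_opNorm z
      have hz0 := norm_nonneg z
      have hzz : K * ‖z‖ ^ 2 ≤ K * ‖z‖ := by
        gcongr
        nlinarith [hz.2]
      have hCz : ‖D‖ * ‖z‖ + K * ‖z‖ ≤ (1 + ‖D‖ + K) * ‖z‖ := by nlinarith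
      rw [abs_le] at t1 t2 hD
      have e1 : p x (x + z) = Q ‖z‖ := by rw [hpQ]; simp
      have e2 : p x (x - z) = Q ‖z‖ := by rw [hpQ]; simp
      have e3 : ‖x - (x + z)‖ = ‖z‖ := by simp
      have e4 : ‖x - (x - z)‖ = ‖z‖ := by simp
      have hq2 := hp2 x (x + z)
      have hqP := hpmax x (x + z)
      rw [e1] at hq2 hqP
      simp only [hF, e1, e2, e3, e4]
      refine abs_symm_kernel_le hz0 hz.2.le ?_ (by positivity) hq2 hqP hs1 ?_ ?_ ?_
      · linarith [norm_nonneg D]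
      · rw [abs_le]
        constructor <;> linarith [t1.1, t1.2, hD.1, hD.2]
      · rw [abs_le]
        constructor <;> linarith [t2.1, t2.2, hD.1, hD.2]
      · rw [abs_le]
        constructor <;> linarith [t1.1, t1.2, t2.1, t2.2]
    · exact Measurable.aestronglyMeasurable (by fun_prop)
  exact ⟨_, tendsto_setIntegral_of_integrableOn_symm (lt_min hδ one_pos) hfar hnear⟩
end

section
/- Under assumption (P1) there exists a constant c₀ > 0, depending only on p⁻ and p⁺ (in particular independent of x and y), with the following property: for all x, y ∈ ℝ^N and all t₁, t₂ ∈ ℝ there exists α lying in the closed interval between t₁ and t₂ such that f(t₂) − f(t₁) = f′(α)(t₂ − t₁), where f(t) = |t|^{p(x,y)−2} t (so f′(t) = (p(x,y)−1)|t|^{p(x,y)−2}), and moreover |α|^{p(x,y)−2} ≥ c₀ · max{ |t₁|^{p(x,y)−2}, |t₂|^{p(x,y)−2} }. -/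
open MeasureTheory Filter Set

/-- For `q > 0` the odd power `t ↦ |t| ^ q * t` is differentiable, also at the origin. -/
theorem hasDerivAt_abs_rpow_mul_self {q : ℝ} (hq : 0 < q) (x : ℝ) :
    HasDerivAt (fun t : ℝ => |t| ^ q * t) ((q + 1) * |x| ^ q) x := by
  have hpow : Continuous fun t : ℝ => |t| ^ q :=
    continuous_abs.rpow_const fun _ => Or.inr hq.le
  have hne : ∀ y : ℝ, y ≠ 0 → HasDerivAt (fun t : ℝ => |t| ^ q * t) ((q + 1) * |y| ^ q) y := by
    intro y hy
    have h := ((hasDerivAt_abs hy).rpow_const (p := q) (Or.inl (abs_ne_zero.2 hy))).mul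
      (hasDerivAt_id y)
    refine h.congr_deriv ?_
    have hs : (SignType.sign y : ℝ) * y = |y| := sign_mul_self y
    have hr : |y| ^ (q - 1) * |y| = |y| ^ q := by
      rw [← Real.rpow_add_one (abs_ne_zero.2 hy), sub_add_cancel]
    simp only [id]
    linear_combination q * |y| ^ (q - 1) * hs + q * hr
  by_cases hx : x = 0
  · subst hx
    exact hasDerivAt_of_hasDerivAt_of_ne hne (hpow.mul continuous_id).continuousAt
      (continuous_const.mul hpow).continuousAt
  · exact hne x hx

/-- Quantitative monotonicity of the odd power `t ↦ |t| ^ q * t`. -/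
theorem half_max_mul_sq_le_abs_rpow_mul_sub {q : ℝ} (hq : 0 ≤ q) (a b : ℝ) :
    max (|a| ^ q) (|b| ^ q) / 2 * (b - a) ^ 2 ≤ (|b| ^ q * b - |a| ^ q * a) * (b - a) := by
  have hA : 0 ≤ |a| ^ q := by positivity
  have hB : 0 ≤ |b| ^ q := by positivity
  have hmono : 0 ≤ (|b| ^ q - |a| ^ q) * (b ^ 2 - a ^ 2) := by
    rcases le_total |a| |b| with h | h
    · exact mul_nonneg (sub_nonneg.2 (Real.rpow_le_rpow (abs_nonneg a) h hq))
        (sub_nonneg.2 (sq_le_sq.2 h))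
    · exact mul_nonneg_of_nonpos_of_nonpos
        (sub_nonpos.2 (Real.rpow_le_rpow (abs_nonneg b) h hq)) (sub_nonpos.2 (sq_le_sq.2 h))
  have hmax : max (|a| ^ q) (|b| ^ q) * (b - a) ^ 2 ≤ (|a| ^ q + |b| ^ q) * (b - a) ^ 2 :=
    mul_le_mul_of_nonneg_right (max_le (by linarith) (by linarith)) (sq_nonneg _)
  linarith

/-- A mean value point of `t ↦ |t| ^ q * t` may be chosen comparable to the larger endpoint. -/
theorem exists_mean_value_abs_rpow_mul_self {q : ℝ} (hq : 0 < q) (a b : ℝ) :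
    ∃ α ∈ uIcc a b, |b| ^ q * b - |a| ^ q * a = (q + 1) * |α| ^ q * (b - a) ∧
      max (|a| ^ q) (|b| ^ q) ≤ 2 * (q + 1) * |α| ^ q := by
  have key : ∃ α ∈ uIcc a b, |b| ^ q * b - |a| ^ q * a = (q + 1) * |α| ^ q * (b - a) := by
    have aux : ∀ u v : ℝ, u < v → ∃ α ∈ Icc u v,
        |v| ^ q * v - |u| ^ q * u = (q + 1) * |α| ^ q * (v - u) := by
      intro u v huv
      obtain ⟨α, hα, h⟩ := exists_hasDerivAt_eq_slope (fun t : ℝ => |t| ^ q * t) _ huv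
        (fun x _ => (hasDerivAt_abs_rpow_mul_self hq x).continuousAt.continuousWithinAt)
        (fun x _ => hasDerivAt_abs_rpow_mul_self hq x)
      exact ⟨α, Ioo_subset_Icc_self hα, ((eq_div_iff (sub_pos.2 huv).ne').1 h).symm⟩
    rcases lt_trichotomy a b with h | rfl | h
    · rw [uIcc_of_le h.le]
      exact aux a b h
    · exact ⟨a, left_mem_uIcc, by ring⟩
    · obtain ⟨α, hα, h'⟩ := aux b a h
      rw [uIcc_of_ge h.le]
      exact ⟨α, hα, by linarith⟩
  obtain ⟨α, hα, h⟩ := key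
  by_cases hab : a = b
  · subst hab
    obtain rfl : α = a := by simpa using hα
    refine ⟨α, hα, h, ?_⟩
    have : 0 ≤ |α| ^ q := by positivity
    rw [max_self]
    nlinarith
  · refine ⟨α, hα, h, ?_⟩
    have hpos : 0 < (b - a) ^ 2 := by
      have := sub_ne_zero.2 (Ne.symm hab)
      positivity
    have hle := half_max_mul_sq_le_abs_rpow_mul_sub hq.le a b
    rw [h, mul_assoc _ (b - a), ← sq] at hle
    linarith [le_of_mul_le_mul_right hle hpos]

theorem stmt2 (N : ℕ) [NeZero N] (s : ℝ) (hs0 : 0 < s) (hs1 : s < 1)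
    (p : EuclideanSpace ℝ (Fin N) → EuclideanSpace ℝ (Fin N) → ℝ)
    (pminus pplus m : ℝ)
    -- (P1)
    (hp_cont : Continuous (fun z : EuclideanSpace ℝ (Fin N) × EuclideanSpace ℝ (Fin N) => p z.1 z.2))
    (hp2 : ∀ x y, 2 < p x y)
    (hpmin : ∀ x y, pminus ≤ p x y) (hpmin_att : ∃ x y, p x y = pminus)
    (hpmax : ∀ x y, p x y ≤ pplus) (hpmax_att : ∃ x y, p x y = pplus)
    (hm0 : 0 < m) (hm1 : m < 1) (hmlog : 1 - 1 / Real.log m < pminus)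
    (hspN : s * pplus < N) :
    ∃ c₀ : ℝ, 0 < c₀ ∧
      ∀ x y : EuclideanSpace ℝ (Fin N), ∀ t₁ t₂ : ℝ,
        ∃ α ∈ Set.uIcc t₁ t₂,
          |t₂| ^ (p x y - 2) * t₂ - |t₁| ^ (p x y - 2) * t₁
              = (p x y - 1) * |α| ^ (p x y - 2) * (t₂ - t₁)
            ∧ c₀ * max (|t₁| ^ (p x y - 2)) (|t₂| ^ (p x y - 2)) ≤ |α| ^ (p x y - 2) := by
  have hpp : 2 < pplus := (hp2 0 0).trans_le (hpmax 0 0)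
  have hpos : 0 < pplus - 1 := by linarith
  refine ⟨1 / (2 * (pplus - 1)), by positivity, fun x y t₁ t₂ => ?_⟩
  obtain ⟨α, hα, h, hmax⟩ :=
    exists_mean_value_abs_rpow_mul_self (q := p x y - 2) (by linarith [hp2 x y]) t₁ t₂
  refine ⟨α, hα, by rw [h]; ring, ?_⟩
  rw [one_div_mul_eq_div, div_le_iff₀' (by linarith)]
  refine hmax.trans (mul_le_mul_of_nonneg_right ?_ (by positivity))
  linarith [hpmax x y]
end

section
/- (Strong maximum principle.) Let Ω be a bounded open set in ℝ^N and assume (P1)–(P2). Let u ∈ C^{1,1}_loc(ℝ^N) ∩ L_{sp(x,·)} be lower semicontinuous on the closure of Ω and satisfy: for every x ∈ Ω the principal value limit defining (-Δ)^s_{p(x,·)}u(x) exists and (-Δ)^s_{p(x,·)}u(x) ≥ 0, and u(x) ≥ 0 for all x ∈ ℝ^N \ Ω. Then u(x) ≥ 0 for all x ∈ Ω. Moreover, if u(x₀) = 0 at some point x₀ ∈ Ω, then u = 0 almost everywhere in ℝ^N. -/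
open MeasureTheory Filter Set

/-- The integrand of the fractional `p(x,·)`-Laplacian is integrable away from the singularity. -/
theorem integrableOn_fracLaplacian_integrand {N : ℕ} {s : ℝ} (hs0 : 0 < s)
    {p : EuclideanSpace ℝ (Fin N) → ℝ} {pplus : ℝ}
    (hp_cont : Continuous p) (hp2 : ∀ y, 2 < p y) (hpmax : ∀ y, p y ≤ pplus)
    {u : EuclideanSpace ℝ (Fin N) → ℝ} (hu : Continuous u) (x : EuclideanSpace ℝ (Fin N))
    (hu_int : Integrable (fun y => |u y| ^ (p y - 1) / (1 + ‖y‖ ^ ((N : ℝ) + s * p y))))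
    {ε : ℝ} (hε : 0 < ε) :
    IntegrableOn (fun y => |u x - u y| ^ (p y - 2) * (u x - u y) / ‖x - y‖ ^ ((N : ℝ) + s * p y))
      {y | ε < ‖y - x‖} := by
  set K : ℝ := 1 + (1 + ‖x‖) / ε with hK
  have hK1 : 1 ≤ K := le_add_of_nonneg_right (by positivity)
  set C : ℝ := 2 ^ pplus * K ^ ((N : ℝ) + s * pplus) with hC
  have hpp : 2 < pplus := (hp2 x).trans_le (hpmax x)
  have hC0 : 0 ≤ C := by positivity
  have htail : Integrable (fun y : EuclideanSpace ℝ (Fin N) =>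
      (1 + ‖y‖) ^ (-((N : ℝ) + s * 2))) :=
    integrable_one_add_norm (by simp; positivity)
  have hdom := ((htail.const_mul ((1 + |u x|) ^ pplus)).add (hu_int.const_mul 2)).const_mul C
  refine (hdom.integrableOn (s := {y | ε < ‖y - x‖})).mono' ?_ ?_
  · have hm : Measurable u := hu.measurable
    have hpm : Measurable p := hp_cont.measurable
    exact Measurable.aestronglyMeasurable (by fun_prop)
  · refine (ae_restrict_iff' (measurableSet_lt (by fun_prop) (by fun_prop))).2
      (Eventually.of_forall fun y hy => ?_)
    have hy : ε < ‖y - x‖ := hy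
    have h2 := hp2 y
    have hM := hpmax y
    have hr : 0 < ‖x - y‖ := by rw [norm_sub_rev]; exact hε.trans hy
    set q : ℝ := (N : ℝ) + s * p y with hq
    have hN : (0 : ℝ) ≤ N := Nat.cast_nonneg N
    have hq2 : (N : ℝ) + s * 2 ≤ q := by rw [hq]; gcongr
    have hqM : q ≤ (N : ℝ) + s * pplus := by rw [hq]; gcongr
    have hq0 : 0 < q := by nlinarith
    have hA : 0 < 1 + ‖y‖ := by positivity
    have hnum : |(|u x - u y| ^ (p y - 2) * (u x - u y))| = |u x - u y| ^ (p y - 1) := by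
      rw [abs_mul, abs_of_nonneg (by positivity : 0 ≤ |u x - u y| ^ (p y - 2)),
        ← Real.rpow_add_one' (abs_nonneg _) (by linarith)]
      ring_nf
    have hmax : |u x - u y| ≤ 2 * max |u x| |u y| := by
      have := abs_sub (u x) (u y)
      have := le_max_left |u x| |u y|
      have := le_max_right |u x| |u y|
      linarith
    have hsplit : |u x - u y| ^ (p y - 1) ≤
        2 ^ pplus * (|u x| ^ (p y - 1) + |u y| ^ (p y - 1)) := by
      calc |u x - u y| ^ (p y - 1) ≤ (2 * max |u x| |u y|) ^ (p y - 1) :=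
            Real.rpow_le_rpow (abs_nonneg _) hmax (by linarith)
        _ = 2 ^ (p y - 1) * (max |u x| |u y|) ^ (p y - 1) :=
            Real.mul_rpow (by norm_num) (by positivity)
        _ ≤ 2 ^ pplus * (|u x| ^ (p y - 1) + |u y| ^ (p y - 1)) := by
            refine mul_le_mul (Real.rpow_le_rpow_of_exponent_le (by norm_num) (by linarith)) ?_
              (by positivity) (by positivity)
            rcases max_choice |u x| |u y| with h | h <;> rw [h]
            · exact le_add_of_nonneg_right (by positivity)
            · exact le_add_of_nonneg_left (by positivity)
    have hux : |u x| ^ (p y - 1) ≤ (1 + |u x|) ^ pplus :=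
      (Real.rpow_le_rpow (abs_nonneg _) (by linarith [abs_nonneg (u x)]) (by linarith)).trans
        (Real.rpow_le_rpow_of_exponent_le (by linarith [abs_nonneg (u x)]) (by linarith))
    have hgrow : 1 + ‖y‖ ≤ K * ‖x - y‖ := by
      have h1 : ‖y‖ ≤ ‖x‖ + ‖x - y‖ := by
        rw [norm_sub_rev]; simpa using norm_add_le x (y - x)
      have h3 : 1 + ‖x‖ ≤ (1 + ‖x‖) / ε * ‖x - y‖ := by
        rw [div_mul_eq_mul_div, le_div_iff₀ hε, norm_sub_rev]
        gcongr
      rw [hK]; linarith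
    have hpow : (1 + ‖y‖) ^ q ≤ K ^ ((N : ℝ) + s * pplus) * ‖x - y‖ ^ q := by
      calc (1 + ‖y‖) ^ q ≤ (K * ‖x - y‖) ^ q := Real.rpow_le_rpow hA.le hgrow hq0.le
        _ = K ^ q * ‖x - y‖ ^ q := Real.mul_rpow (by positivity) hr.le
        _ ≤ _ := by gcongr
    have hinv : (‖x - y‖ ^ q)⁻¹ ≤ K ^ ((N : ℝ) + s * pplus) * ((1 + ‖y‖) ^ q)⁻¹ := by
      rw [← div_eq_mul_inv, le_div_iff₀ (by positivity), inv_mul_le_iff₀ (by positivity)]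
      linarith
    have htl : ((1 + ‖y‖) ^ q)⁻¹ ≤ (1 + ‖y‖) ^ (-((N : ℝ) + s * 2)) := by
      rw [← Real.rpow_neg hA.le]
      exact Real.rpow_le_rpow_of_exponent_le (by linarith [norm_nonneg y]) (by linarith)
    have hden : ((1 + ‖y‖) ^ q)⁻¹ ≤ 2 * (1 + ‖y‖ ^ q)⁻¹ := by
      rw [← div_eq_mul_inv, le_div_iff₀ (by positivity), inv_mul_le_iff₀ (by positivity)]
      have h1 : 1 ≤ (1 + ‖y‖) ^ q := Real.one_le_rpow (by linarith [norm_nonneg y]) hq0.le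
      have h3 : ‖y‖ ^ q ≤ (1 + ‖y‖) ^ q :=
        Real.rpow_le_rpow (norm_nonneg _) (by linarith) hq0.le
      linarith
    rw [Real.norm_eq_abs, abs_div, hnum, abs_of_pos (by positivity : 0 < ‖x - y‖ ^ q),
      div_eq_mul_inv]
    calc |u x - u y| ^ (p y - 1) * (‖x - y‖ ^ q)⁻¹
        ≤ (2 ^ pplus * (|u x| ^ (p y - 1) + |u y| ^ (p y - 1))) *
          (K ^ ((N : ℝ) + s * pplus) * ((1 + ‖y‖) ^ q)⁻¹) := by gcongr
      _ = C * (|u x| ^ (p y - 1) * ((1 + ‖y‖) ^ q)⁻¹ +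
          |u y| ^ (p y - 1) * ((1 + ‖y‖) ^ q)⁻¹) := by rw [hC]; ring
      _ ≤ C * ((1 + |u x|) ^ pplus * (1 + ‖y‖) ^ (-((N : ℝ) + s * 2)) +
          |u y| ^ (p y - 1) * (2 * (1 + ‖y‖ ^ q)⁻¹)) := by gcongr
      _ = _ := by simp only [Pi.add_apply]; rw [div_eq_mul_inv]; ring

/-- If the fractional `p(x,·)`-Laplacian of `u` exists and is nonnegative at a global minimum point
of `u`, then `u` is almost everywhere equal to its minimum. -/
theorem ae_eq_of_isMin_of_fracLaplacian_nonneg {N : ℕ} {s : ℝ} (hs0 : 0 < s)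
    {p : EuclideanSpace ℝ (Fin N) → ℝ} {pplus : ℝ}
    (hp_cont : Continuous p) (hp2 : ∀ y, 2 < p y) (hpmax : ∀ y, p y ≤ pplus)
    {u : EuclideanSpace ℝ (Fin N) → ℝ} (hu : Continuous u) {x : EuclideanSpace ℝ (Fin N)}
    (hu_int : Integrable (fun y => |u y| ^ (p y - 1) / (1 + ‖y‖ ^ ((N : ℝ) + s * p y))))
    (hmin : ∀ y, u x ≤ u y) {L : ℝ} (hL : 0 ≤ L)
    (hlim : Tendsto (fun ε : ℝ => ∫ y in {y : EuclideanSpace ℝ (Fin N) | ε < ‖y - x‖},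
          |u x - u y| ^ (p y - 2) * (u x - u y) / ‖x - y‖ ^ ((N : ℝ) + s * p y))
        (nhdsWithin 0 (Set.Ioi 0)) (nhds L)) :
    ∀ᵐ y, u y = u x := by
  set f : EuclideanSpace ℝ (Fin N) → ℝ := fun y =>
    |u x - u y| ^ (p y - 2) * (u x - u y) / ‖x - y‖ ^ ((N : ℝ) + s * p y) with hf
  have hint : ∀ ε > 0, IntegrableOn f {y | ε < ‖y - x‖} := fun ε hε =>
    integrableOn_fracLaplacian_integrand hs0 hp_cont hp2 hpmax hu x hu_int hε
  have hneg : ∀ y, 0 ≤ -f y := fun y => neg_nonneg.2 <|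
    div_nonpos_of_nonpos_of_nonneg
      (mul_nonpos_of_nonneg_of_nonpos (by positivity) (sub_nonpos.2 (hmin y))) (by positivity)
  have hms : ∀ ε : ℝ, MeasurableSet {y : EuclideanSpace ℝ (Fin N) | ε < ‖y - x‖} := fun ε =>
    measurableSet_lt (by fun_prop) (by fun_prop)
  have hzero : ∀ ε > 0, ∀ᵐ y, ε < ‖y - x‖ → f y = 0 := by
    intro ε hε
    have hmono : ∀ᶠ δ in nhdsWithin (0 : ℝ) (Ioi 0),
        ∫ y in {y | δ < ‖y - x‖}, f y ≤ ∫ y in {y | ε < ‖y - x‖}, f y := by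
      filter_upwards [Ioo_mem_nhdsGT hε] with δ hδ
      have := setIntegral_mono_set (hint δ hδ.1).neg (Eventually.of_forall hneg)
        (Eventually.of_forall fun y (hy : ε < ‖y - x‖) => hδ.2.trans hy :
          {y | ε < ‖y - x‖} ≤ᵐ[volume] {y | δ < ‖y - x‖})
      simp only [Pi.neg_apply, integral_neg] at this
      linarith
    have hge : 0 ≤ ∫ y in {y | ε < ‖y - x‖}, f y := hL.trans (le_of_tendsto hlim hmono)
    have hle : 0 ≤ ∫ y in {y | ε < ‖y - x‖}, -f y := integral_nonneg hneg
    have heq : ∫ y in {y | ε < ‖y - x‖}, -f y = 0 := by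
      rw [integral_neg] at hle ⊢; linarith
    have := (integral_eq_zero_iff_of_nonneg hneg (hint ε hε).neg).1 heq
    filter_upwards [(ae_restrict_iff' (hms ε)).1 this] with y hy h
    simpa using hy h
  have hall : ∀ᵐ y, ∀ n : ℕ, 1 / ((n : ℝ) + 1) < ‖y - x‖ → f y = 0 :=
    ae_all_iff.2 fun n => hzero _ (by positivity)
  filter_upwards [hall] with y hy
  by_contra hne
  have hyx : 0 < ‖y - x‖ := norm_pos_iff.2 (sub_ne_zero.2 fun h => hne (by rw [h]))
  obtain ⟨n, hn⟩ := exists_nat_one_div_lt hyx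
  have hux : u x - u y ≠ 0 := sub_ne_zero.2 (Ne.symm hne)
  have hr : 0 < ‖x - y‖ := by rwa [norm_sub_rev]
  have hpos : 0 < |u x - u y| := abs_pos.2 hux
  exact div_ne_zero (mul_ne_zero (Real.rpow_pos_of_pos hpos _).ne' hux)
    (Real.rpow_pos_of_pos hr _).ne' (hy n hn)

theorem stmt4 (N : ℕ) [NeZero N] (s : ℝ) (hs0 : 0 < s) (hs1 : s < 1)
    (p : EuclideanSpace ℝ (Fin N) → EuclideanSpace ℝ (Fin N) → ℝ)
    (pminus pplus m : ℝ) (Q : ℝ → ℝ)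
    -- (P1)
    (hp_cont : Continuous (fun z : EuclideanSpace ℝ (Fin N) × EuclideanSpace ℝ (Fin N) => p z.1 z.2))
    (hp2 : ∀ x y, 2 < p x y)
    (hpmin : ∀ x y, pminus ≤ p x y) (hpmin_att : ∃ x y, p x y = pminus)
    (hpmax : ∀ x y, p x y ≤ pplus) (hpmax_att : ∃ x y, p x y = pplus)
    (hm0 : 0 < m) (hm1 : m < 1) (hmlog : 1 - 1 / Real.log m < pminus)
    (hspN : s * pplus < N)
    -- (P2)
    (hQcont : Continuous Q) (hQmono : MonotoneOn Q (Set.Ici 0))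
    (hpQ : ∀ x y, p x y = Q ‖x - y‖)
    (hQtt : StrictMonoOn (fun t : ℝ => t ^ Q t) (Set.Ioi 0))
    -- domain
    (Ω : Set (EuclideanSpace ℝ (Fin N))) (hΩ_open : IsOpen Ω)
    (hΩ_bdd : Bornology.IsBounded Ω)
    -- u ∈ C^{1,1}_loc ∩ L_{sp(x,·)}, lower semicontinuous on the closure of Ω
    (u : EuclideanSpace ℝ (Fin N) → ℝ)
    (hu_C1 : ContDiff ℝ 1 u) (hu_lip : LocallyLipschitz (fderiv ℝ u))
    (hu_loc : LocallyIntegrable u)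
    (hu_Lsp : ∀ x, Integrable (fun y : EuclideanSpace ℝ (Fin N) =>
        |u y| ^ (p x y - 1) / (1 + ‖y‖ ^ ((N : ℝ) + s * p x y))))
    (hu_lsc : LowerSemicontinuousOn u (closure Ω))
    -- (-Δ)^s_{p(x,·)} u (x) exists and is ≥ 0 in Ω
    (hfrac : ∀ x ∈ Ω, ∃ L : ℝ, 0 ≤ L ∧ Tendsto
        (fun ε : ℝ => ∫ y in {y : EuclideanSpace ℝ (Fin N) | ε < ‖y - x‖},
          |u x - u y| ^ (p x y - 2) * (u x - u y) / ‖x - y‖ ^ ((N : ℝ) + s * p x y))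
        (nhdsWithin 0 (Set.Ioi 0)) (nhds L))
    -- u ≥ 0 outside Ω
    (hout : ∀ x, x ∉ Ω → 0 ≤ u x) :
    (∀ x ∈ Ω, 0 ≤ u x) ∧
      (∀ x₀ ∈ Ω, u x₀ = 0 → ∀ᵐ y : EuclideanSpace ℝ (Fin N), u y = 0) := by
  have hu : Continuous u := hu_C1.continuous
  have key : ∀ x ∈ Ω, (∀ y, u x ≤ u y) → ∀ᵐ y, u y = u x := by
    intro x hx hmin
    obtain ⟨L, hL, hlim⟩ := hfrac x hx
    exact ae_eq_of_isMin_of_fracLaplacian_nonneg hs0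
      (hp_cont.comp (Continuous.prodMk_right x)) (hp2 x) (hpmax x) hu (hu_Lsp x) hmin hL hlim
  have hnonneg : ∀ x ∈ Ω, 0 ≤ u x := by
    by_contra! ⟨x, hx, hux⟩
    obtain ⟨x₀, -, hx₀⟩ := hΩ_bdd.isCompact_closure.exists_isMinOn ⟨x, subset_closure hx⟩
      hu.continuousOn
    have hux₀ : u x₀ < 0 := (hx₀ (subset_closure hx)).trans_lt hux
    have hmin : ∀ y, u x₀ ≤ u y := fun y => by
      by_cases hy : y ∈ Ω
      · exact hx₀ (subset_closure hy)
      · exact hux₀.le.trans (hout y hy)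
    have hmem : x₀ ∈ Ω := by
      by_contra h
      exact hux₀.not_ge (hout x₀ h)
    have hconst : u = fun _ => u x₀ :=
      (hu.ae_eq_iff_eq volume continuous_const).1 (key x₀ hmem hmin)
    obtain ⟨z, hz⟩ : ∃ z, z ∉ Ω := by
      by_contra! h
      exact NormedSpace.unbounded_univ ℝ (EuclideanSpace ℝ (Fin N)) (eq_univ_of_forall h ▸ hΩ_bdd)
    have := hout z hz
    rw [congrFun hconst z] at this
    exact hux₀.not_ge this
  refine ⟨hnonneg, fun x₀ hx₀ h0 => ?_⟩
  have hmin : ∀ y, u x₀ ≤ u y := fun y => by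
    rw [h0]
    by_cases hy : y ∈ Ω
    · exact hnonneg y hy
    · exact hout y hy
  simpa [h0] using key x₀ hx₀ hmin
end

section
/- Assume (P1)–(P2) and let u ∈ C^{1,1}_loc(ℝ^N). Then for every x ∈ ℝ^N the limit lim_{ε→0⁺} ∫_{{y ∈ ℝ^N : ε < |x−y| < 1}} |u(x)−u(y)|^{p(x,y)−2}(u(x)−u(y)) / |x−y|^{N+s·p(x,y)} dy exists and is finite. -/
open MeasureTheory Filter Set

/-- The map `t ↦ |t| ^ α * t` is odd and Lipschitz on bounded intervals. -/
theorem abs_rpow_mul_self_add_le {α R a b : ℝ} (hα : 0 < α) (ha : |a| ≤ R) (hb : |b| ≤ R) :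
    |(|a| ^ α * a + |b| ^ α * b)| ≤ (α + 1) * R ^ α * |a + b| := by
  have hR : 0 ≤ R := (abs_nonneg a).trans ha
  have hRα : 0 ≤ R ^ α := Real.rpow_nonneg hR α
  have pow_eq : ∀ t : ℝ, 0 ≤ t → |t| ^ α * t = t ^ (α + 1) := fun t ht ↦ by
    rw [abs_of_nonneg ht, Real.rpow_add_one' ht (by positivity)]
  have mvt : ∀ c d : ℝ, c ∈ Icc 0 R → d ∈ Icc 0 R →
      |(d ^ (α + 1) - c ^ (α + 1))| ≤ (α + 1) * R ^ α * |d - c| := by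
    intro c d hc hd
    refine (convex_Icc (0 : ℝ) R).norm_image_sub_le_of_norm_hasDerivWithin_le
      (f := fun t : ℝ ↦ t ^ (α + 1)) (f' := fun t ↦ (α + 1) * t ^ (α + 1 - 1))
      (fun t _ ↦ (Real.hasDerivAt_rpow_const (Or.inr (by linarith))).hasDerivWithinAt)
      (fun t ht ↦ ?_) hc hd
    rw [add_sub_cancel_right, Real.norm_of_nonneg
      (mul_nonneg (by positivity) (Real.rpow_nonneg ht.1 _))]
    exact mul_le_mul_of_nonneg_left (Real.rpow_le_rpow ht.1 ht.2 hα.le) (by positivity)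
  have same : ∀ c d : ℝ, 0 ≤ c * d → |c| ≤ R → |d| ≤ R →
      |(|c| ^ α * c + |d| ^ α * d)| ≤ (α + 1) * R ^ α * |c + d| := by
    intro c d hcd hc hd
    have h1 : |c| ^ α ≤ R ^ α := Real.rpow_le_rpow (abs_nonneg _) hc hα.le
    have h2 : |d| ^ α ≤ R ^ α := Real.rpow_le_rpow (abs_nonneg _) hd hα.le
    have h3 : |c + d| = |c| + |d| := (abs_add_eq_add_abs_iff c d).2 (mul_nonneg_iff.1 hcd)
    calc |(|c| ^ α * c + |d| ^ α * d)| ≤ |c| ^ α * |c| + |d| ^ α * |d| := by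
          refine (abs_add_le _ _).trans_eq ?_
          rw [abs_mul, abs_mul, Real.abs_rpow_of_nonneg (abs_nonneg _),
            Real.abs_rpow_of_nonneg (abs_nonneg _), abs_abs, abs_abs]
      _ ≤ R ^ α * |c| + R ^ α * |d| := by gcongr
      _ = R ^ α * |c + d| := by rw [h3]; ring
      _ ≤ (α + 1) * R ^ α * |c + d| := by
          gcongr
          nlinarith
  rcases le_total 0 a with h0a | h0a <;> rcases le_total 0 b with h0b | h0b
  · exact same a b (mul_nonneg h0a h0b) ha hb
  · have := mvt (-b) a ⟨by linarith, (neg_le_abs b).trans hb⟩ ⟨h0a, (le_abs_self a).trans ha⟩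
    rw [← pow_eq a h0a, ← pow_eq (-b) (by linarith), abs_neg] at this
    simpa using this
  · have := mvt (-a) b ⟨by linarith, (neg_le_abs a).trans ha⟩ ⟨h0b, (le_abs_self b).trans hb⟩
    rw [← pow_eq b h0b, ← pow_eq (-a) (by linarith), abs_neg] at this
    rw [add_comm, add_comm a]
    simpa using this
  · exact same a b (mul_nonneg_of_nonpos_of_nonpos h0a h0b) ha hb

/-- Powers of the norm are integrable near the origin when the exponent exceeds minus the
dimension. -/
theorem integrable_indicator_ball_norm_rpow {E : Type*} [NormedAddCommGroup E] [NormedSpace ℝ E]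
    [FiniteDimensional ℝ E] [Nontrivial E] [MeasurableSpace E] [BorelSpace E] (μ : Measure E)
    [μ.IsAddHaarMeasure] {β : ℝ} (hβ : -(Module.finrank ℝ E : ℝ) < β) :
    Integrable (fun z : E ↦ (Iio (1 : ℝ)).indicator (fun r ↦ r ^ β) ‖z‖) μ := by
  rw [integrable_fun_norm_addHaar]
  have h1 : IntegrableOn (fun r : ℝ ↦ r ^ ((Module.finrank ℝ E : ℝ) - 1 + β)) (Ioo 0 1) :=
    (intervalIntegral.integrableOn_Ioo_rpow_iff one_pos).2 (by linarith)
  have h2 := (integrable_indicator_iff measurableSet_Ioo).2 h1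
  refine (h2.integrableOn (s := Ioi 0)).congr_fun (fun r hr ↦ ?_) measurableSet_Ioi
  have hr : 0 < r := hr
  by_cases h : r < 1
  · rw [indicator_of_mem (show r ∈ Ioo (0 : ℝ) 1 from ⟨hr, h⟩),
      indicator_of_mem (show r ∈ Iio (1 : ℝ) from h), smul_eq_mul, Real.rpow_add hr,
      ← Real.rpow_natCast, Nat.cast_sub Module.finrank_pos, Nat.cast_one]
  · rw [indicator_of_notMem (show r ∉ Ioo (0 : ℝ) 1 from fun h' ↦ h h'.2),
      indicator_of_notMem (show r ∉ Iio (1 : ℝ) from h), smul_zero]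

/-- A function whose symmetrization is dominated by an integrable power of the norm has a
principal value at the origin. -/
theorem exists_tendsto_integral_annulus {E : Type*} [NormedAddCommGroup E] [NormedSpace ℝ E]
    [FiniteDimensional ℝ E] [Nontrivial E] [MeasurableSpace E] [BorelSpace E] (μ : Measure E)
    [μ.IsAddHaarMeasure] {β C : ℝ} (hβ : -(Module.finrank ℝ E : ℝ) < β) {F : E → ℝ}
    (hF : ∀ ε > 0, IntegrableOn F {z | ε < ‖z‖ ∧ ‖z‖ < 1} μ)
    (hC : ∀ z, 0 < ‖z‖ → ‖z‖ < 1 → |F z + F (-z)| ≤ C * ‖z‖ ^ β) :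
    ∃ L : ℝ, Tendsto (fun ε : ℝ ↦ ∫ z in {z | ε < ‖z‖ ∧ ‖z‖ < 1}, F z ∂μ)
      (nhdsWithin 0 (Ioi 0)) (nhds L) := by
  have hA : ∀ ε : ℝ, MeasurableSet {z : E | ε < ‖z‖ ∧ ‖z‖ < 1} := fun ε ↦
    (measurableSet_lt measurable_const measurable_norm).inter
      (measurableSet_lt measurable_norm measurable_const)
  let I : ℝ → E → ℝ := fun ε ↦ {z : E | ε < ‖z‖ ∧ ‖z‖ < 1}.indicator F
  have hI : ∀ ε > 0, Integrable (I ε) μ := fun ε hε ↦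
    (integrable_indicator_iff (hA ε)).2 (hF ε hε)
  have hsym : ∀ ε > 0, ∫ z in {z | ε < ‖z‖ ∧ ‖z‖ < 1}, F z ∂μ
      = (∫ z, (I ε z + I ε (-z)) ∂μ) / 2 := by
    intro ε hε
    rw [integral_add (hI ε hε) (hI ε hε).comp_neg, integral_neg_eq_self (I ε) μ,
      ← integral_indicator (hA ε)]
    ring
  have hI_eq : ∀ ε z, ε < ‖z‖ → ‖z‖ < 1 → I ε z + I ε (-z) = F z + F (-z) := by
    intro ε z h1 h2
    simp only [I]
    rw [indicator_of_mem (show z ∈ {z : E | ε < ‖z‖ ∧ ‖z‖ < 1} from ⟨h1, h2⟩),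
      indicator_of_mem (show -z ∈ {z : E | ε < ‖z‖ ∧ ‖z‖ < 1} by simpa using ⟨h1, h2⟩)]
  have hI_zero : ∀ ε z, ¬ (ε < ‖z‖ ∧ ‖z‖ < 1) → I ε z + I ε (-z) = 0 := by
    intro ε z h
    simp only [I]
    rw [indicator_of_notMem (show z ∉ {z : E | ε < ‖z‖ ∧ ‖z‖ < 1} from h),
      indicator_of_notMem (show -z ∉ {z : E | ε < ‖z‖ ∧ ‖z‖ < 1} by simpa using h), add_zero]
  refine ⟨(∫ z, (I 0 z + I 0 (-z)) ∂μ) / 2, ?_⟩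
  refine Tendsto.congr' (eventually_nhdsWithin_of_forall fun ε hε ↦ (hsym ε hε).symm) ?_
  refine Tendsto.div_const (l := nhdsWithin 0 (Ioi 0)) (tendsto_integral_filter_of_dominated_convergence
    (F := fun ε z ↦ I ε z + I ε (-z))
    (fun z ↦ |C| * (Iio (1 : ℝ)).indicator (fun r ↦ r ^ β) ‖z‖)
    (eventually_nhdsWithin_of_forall fun ε hε ↦
      ((hI ε hε).add (hI ε hε).comp_neg).aestronglyMeasurable)
    (eventually_nhdsWithin_of_forall fun ε hε ↦ Eventually.of_forall fun z ↦ ?_)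
    ((integrable_indicator_ball_norm_rpow μ hβ).const_mul _)
    (Eventually.of_forall fun z ↦ ?_)) 2
  · by_cases h : ε < ‖z‖ ∧ ‖z‖ < 1
    · rw [hI_eq ε z h.1 h.2, indicator_of_mem (show ‖z‖ ∈ Iio (1 : ℝ) from h.2)]
      refine (hC z (lt_trans hε h.1) h.2).trans ?_
      gcongr
      exact le_abs_self C
    · rw [hI_zero ε z h, norm_zero]
      exact mul_nonneg (abs_nonneg _)
        (indicator_apply_nonneg fun _ ↦ Real.rpow_nonneg (norm_nonneg z) _)
  · by_cases h : 0 < ‖z‖ ∧ ‖z‖ < 1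
    · refine tendsto_const_nhds.congr' ?_
      filter_upwards [nhdsWithin_le_nhds (Iio_mem_nhds h.1)] with ε hε
      rw [hI_eq ε z hε h.2, hI_eq 0 z h.1 h.2]
    · refine tendsto_const_nhds.congr' ?_
      filter_upwards [self_mem_nhdsWithin] with ε hε
      rw [hI_zero 0 z h, hI_zero ε z fun h' ↦ h ⟨lt_trans hε h'.1, h'.2⟩]

/-- A first-order Taylor estimate on the unit ball for functions with locally Lipschitz
derivative. -/
theorem exists_norm_sub_sub_fderiv_le {E : Type*} [NormedAddCommGroup E] [NormedSpace ℝ E]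
    [FiniteDimensional ℝ E] {u : E → ℝ} (hu : Differentiable ℝ u)
    (hu' : LocallyLipschitz (fderiv ℝ u)) (x : E) :
    ∃ K : ℝ, 0 ≤ K ∧ ∀ z, ‖z‖ ≤ 1 → |u (x + z) - u x - fderiv ℝ u x z| ≤ K * ‖z‖ ^ 2 := by
  have : ProperSpace E := FiniteDimensional.proper ℝ E
  obtain ⟨K, hK⟩ := LocallyLipschitzOn.exists_lipschitzOnWith_of_compact
    (isCompact_closedBall x 1) hu'.locallyLipschitzOn
  refine ⟨K, K.2, fun z hz ↦ ?_⟩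
  have h := Convex.norm_image_sub_le_of_norm_fderiv_le' (𝕜 := ℝ) (f := u) (φ := fderiv ℝ u x)
    (C := K * ‖z‖) (s := Metric.closedBall x ‖z‖) (x := x) (y := x + z) (fun y _ ↦ hu y)
    (fun y hy ↦ ?_) (convex_closedBall x ‖z‖) (by simp) (by simp)
  · rw [add_sub_cancel_left, Real.norm_eq_abs, mul_assoc, ← sq] at h
    exact h
  · rw [← dist_eq_norm]
    refine (hK.dist_le_mul y (Metric.closedBall_subset_closedBall hz hy) x (by simp)).trans ?_
    gcongr
    exact hy

theorem stmt13 (N : ℕ) [NeZero N] (s : ℝ) (hs0 : 0 < s) (hs1 : s < 1)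
    (p : EuclideanSpace ℝ (Fin N) → EuclideanSpace ℝ (Fin N) → ℝ)
    (pminus pplus m : ℝ) (Q : ℝ → ℝ)
    -- (P1)
    (hp_cont : Continuous (fun z : EuclideanSpace ℝ (Fin N) × EuclideanSpace ℝ (Fin N) => p z.1 z.2))
    (hp2 : ∀ x y, 2 < p x y)
    (hpmin : ∀ x y, pminus ≤ p x y) (hpmin_att : ∃ x y, p x y = pminus)
    (hpmax : ∀ x y, p x y ≤ pplus) (hpmax_att : ∃ x y, p x y = pplus)
    (hm0 : 0 < m) (hm1 : m < 1) (hmlog : 1 - 1 / Real.log m < pminus)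
    (hspN : s * pplus < N)
    -- (P2)
    (hQcont : Continuous Q) (hQmono : MonotoneOn Q (Set.Ici 0))
    (hpQ : ∀ x y, p x y = Q ‖x - y‖)
    (hQtt : StrictMonoOn (fun t : ℝ => t ^ Q t) (Set.Ioi 0))
    -- u ∈ C^{1,1}_loc
    (u : EuclideanSpace ℝ (Fin N) → ℝ)
    (hu_C1 : ContDiff ℝ 1 u) (hu_lip : LocallyLipschitz (fderiv ℝ u)) :
    ∀ x : EuclideanSpace ℝ (Fin N),
      ∃ L : ℝ, Tendsto
        (fun ε : ℝ => ∫ y in {y : EuclideanSpace ℝ (Fin N) | ε < ‖x - y‖ ∧ ‖x - y‖ < 1},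
          |u x - u y| ^ (p x y - 2) * (u x - u y) / ‖x - y‖ ^ ((N : ℝ) + s * p x y))
        (nhdsWithin 0 (Set.Ioi 0)) (nhds L) := by
  intro x
  have hN : 0 < N := Nat.pos_of_ne_zero (NeZero.ne N)
  have : Nonempty (Fin N) := ⟨⟨0, hN⟩⟩
  let F : EuclideanSpace ℝ (Fin N) → ℝ := fun z ↦
    |u x - u (x + z)| ^ (Q ‖z‖ - 2) * (u x - u (x + z)) / ‖z‖ ^ ((N : ℝ) + s * Q ‖z‖)
  have hQ2 : ∀ z : EuclideanSpace ℝ (Fin N), 2 < Q ‖z‖ := fun z ↦ by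
    simpa [hpQ] using hp2 z 0
  have hQp : ∀ z : EuclideanSpace ℝ (Fin N), Q ‖z‖ ≤ pplus := fun z ↦ by
    simpa [hpQ] using hpmax z 0
  have hp2' : 2 < pplus := (hQ2 0).trans_le (hQp 0)
  obtain ⟨K, hK0, hK⟩ := exists_norm_sub_sub_fderiv_le (hu_C1.differentiable one_ne_zero) hu_lip x
  set φ := fderiv ℝ u x
  let M : ℝ := max 1 (‖φ‖ + K)
  have hM1 : 1 ≤ M := le_max_left _ _
  have hM : ∀ z, ‖z‖ < 1 → |u x - u (x + z)| ≤ M * ‖z‖ := by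
    intro z hz
    have h1 := hK z hz.le
    have h2 : |φ z| ≤ ‖φ‖ * ‖z‖ := φ.le_opNorm z
    have h3 : K * ‖z‖ ^ 2 ≤ K * ‖z‖ := by
      gcongr
      nlinarith [norm_nonneg z]
    calc |u x - u (x + z)| = |(u (x + z) - u x - φ z) + φ z| := by
          rw [abs_sub_comm]; congr 1; ring
      _ ≤ K * ‖z‖ + ‖φ‖ * ‖z‖ := (abs_add_le _ _).trans (add_le_add (h1.trans h3) h2)
      _ = (‖φ‖ + K) * ‖z‖ := by ring
      _ ≤ M * ‖z‖ := by gcongr; exact le_max_right _ _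
  have hsum : ∀ z, ‖z‖ < 1 → |(u x - u (x + z)) + (u x - u (x + -z))| ≤ 2 * K * ‖z‖ ^ 2 := by
    intro z hz
    have h1 := abs_le.1 (hK z hz.le)
    have h2 := abs_le.1 (hK (-z) (by simpa using hz.le))
    rw [norm_neg, map_neg] at h2
    exact abs_le.2 ⟨by linarith [h1.2, h2.2], by linarith [h1.1, h2.1]⟩
  have hF : ∀ ε > 0, IntegrableOn F {z | ε < ‖z‖ ∧ ‖z‖ < 1} := by
    intro ε hε
    have hsub : {z : EuclideanSpace ℝ (Fin N) | ε < ‖z‖ ∧ ‖z‖ < 1}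
        ⊆ Metric.closedBall 0 1 ∩ {z | ε ≤ ‖z‖} := fun z hz ↦ ⟨by simpa using hz.2.le, hz.1.le⟩
    refine IntegrableOn.mono_set (ContinuousOn.integrableOn_compact
      ((isCompact_closedBall _ _).inter_right (isClosed_le continuous_const continuous_norm))
      ?_) hsub
    have hu : Continuous fun z ↦ u x - u (x + z) :=
      continuous_const.sub (hu_C1.continuous.comp (continuous_const.add continuous_id))
    have hQn : Continuous fun z : EuclideanSpace ℝ (Fin N) ↦ Q ‖z‖ := hQcont.comp continuous_norm
    have hpos : ∀ z ∈ Metric.closedBall 0 1 ∩ {z : EuclideanSpace ℝ (Fin N) | ε ≤ ‖z‖}, 0 < ‖z‖ :=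
      fun z hz ↦ hε.trans_le hz.2
    refine ContinuousOn.div (Continuous.continuousOn ?_) (ContinuousOn.rpow
      continuous_norm.continuousOn (continuous_const.add (continuous_const.mul hQn)).continuousOn
      fun z hz ↦ Or.inl (hpos z hz).ne') fun z hz ↦ (Real.rpow_pos_of_pos (hpos z hz) _).ne'
    exact (hu.abs.rpow (hQn.sub continuous_const) fun z ↦ Or.inr (sub_pos.2 (hQ2 z))).mul hu
  have hβ : -(Module.finrank ℝ (EuclideanSpace ℝ (Fin N)) : ℝ) < 2 * (1 - s) - N := by
    rw [finrank_euclideanSpace_fin]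
    linarith
  have hC : ∀ z, 0 < ‖z‖ → ‖z‖ < 1 →
      |F z + F (-z)| ≤ (pplus * M ^ (pplus - 2) * (2 * K)) * ‖z‖ ^ (2 * (1 - s) - N) := by
    intro z hz0 hz1
    have hq2 := hQ2 z
    have hqp := hQp z
    have hb := hM (-z) (by simpa using hz1)
    have hs' := hsum z hz1
    have ha := hM z hz1
    simp only [F, norm_neg]
    rw [norm_neg] at hb
    generalize u x - u (x + z) = a at *
    generalize u x - u (x + -z) = b at *
    generalize Q ‖z‖ = q at *
    generalize ‖z‖ = r at *
    have key := abs_rpow_mul_self_add_le (α := q - 2) (by linarith) ha hb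
    rw [← add_div, abs_div, abs_of_pos (Real.rpow_pos_of_pos hz0 _),
      div_le_iff₀ (Real.rpow_pos_of_pos hz0 _)]
    have hr : r ^ (q - 2) * r ^ 2 ≤ r ^ (2 * (1 - s) - N) * r ^ ((N : ℝ) + s * q) := by
      rw [← Real.rpow_natCast r 2, ← Real.rpow_add hz0, ← Real.rpow_add hz0]
      refine Real.rpow_le_rpow_of_exponent_ge hz0 hz1.le ?_
      push_cast
      nlinarith
    have hMq : M ^ (q - 2) ≤ M ^ (pplus - 2) :=
      Real.rpow_le_rpow_of_exponent_le hM1 (by linarith)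
    have hM0 : 0 ≤ M := by linarith
    calc |(|a| ^ (q - 2) * a + |b| ^ (q - 2) * b)|
        ≤ (q - 2 + 1) * (M * r) ^ (q - 2) * |a + b| := key
      _ ≤ pplus * (M * r) ^ (q - 2) * (2 * K * r ^ 2) := by
          have : 0 ≤ (M * r) ^ (q - 2) := by positivity
          gcongr
          linarith
      _ = (pplus * M ^ (q - 2) * (2 * K)) * (r ^ (q - 2) * r ^ 2) := by
          rw [Real.mul_rpow hM0 hz0.le]; ring
      _ ≤ (pplus * M ^ (pplus - 2) * (2 * K)) *
          (r ^ (2 * (1 - s) - N) * r ^ ((N : ℝ) + s * q)) := by gcongr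
      _ = _ := by ring
  obtain ⟨L, hL⟩ := exists_tendsto_integral_annulus volume hβ hF hC
  refine ⟨L, hL.congr fun ε ↦ ?_⟩
  have hA : MeasurableSet {z : EuclideanSpace ℝ (Fin N) | ε < ‖z‖ ∧ ‖z‖ < 1} :=
    (measurableSet_lt measurable_const measurable_norm).inter
      (measurableSet_lt measurable_norm measurable_const)
  have hB : MeasurableSet {y : EuclideanSpace ℝ (Fin N) | ε < ‖x - y‖ ∧ ‖x - y‖ < 1} :=
    hA.preimage (measurable_const.sub measurable_id)
  rw [← integral_indicator hA, ← integral_indicator hB, ← integral_sub_right_eq_self _ x]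
  refine integral_congr_ae (Eventually.of_forall fun y ↦ ?_)
  simp only [indicator_apply, mem_ofPred_eq, F, hpQ, norm_sub_rev y x, add_sub_cancel]
end
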